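/- arXiv:1112.4250 — 3 statements merged into one kernel-verified Lean document; each statement's English description precedes it below -/
import Mathlib

section
/- If 𝒜 is a semi-flower automaton over a finite alphabet A, then the set Y_𝒜 of labels of cycles simple in 1 is finite, and the language L(𝒜) equals the submonoid of the free monoid A* generated by Y_𝒜. -/
open Pointwise

/-- A finite automaton over an alphabet `A`, given by its finite set of states,
sets of initial and final states, and set of transitions. -/
structure FA (Q A : Type*) where
  states : Finset Q
  I : Finset Q
  T : Finset Q
  F : Finset (Q × A × Q)
  I_sub : I ⊆ states
  T_sub : T ⊆ states
  F_src : ∀ t ∈ F, t.1 ∈ states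
  F_tgt : ∀ t ∈ F, t.2.2 ∈ states

namespace FA

variable {Q Q' A : Type*}

/-- `M.IsPath p ts q` : `ts` is a (possibly null) path of consecutive transitions
from `p` to `q` in `M`. -/
def IsPath (M : FA Q A) : Q → List (Q × A × Q) → Q → Prop
  | p, [], q => p = q
  | p, t :: ts, q => t ∈ M.F ∧ t.1 = p ∧ M.IsPath t.2.2 ts q

/-- The label of a path, as an element of the free monoid `A*`. -/
def label (ts : List (Q × A × Q)) : FreeMonoid A :=
  FreeMonoid.ofList (ts.map fun t => t.2.1)

/-- The states visited by a path starting at `p`. -/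
def statesOf (p : Q) (ts : List (Q × A × Q)) : List Q :=
  p :: ts.map fun t => t.2.2

/-- A state is accessible if some path leads from an initial state to it. -/
def Accessible (M : FA Q A) (q : Q) : Prop := ∃ i ∈ M.I, ∃ ts, M.IsPath i ts q

/-- A state is coaccessible if some path leads from it to a final state. -/
def Coaccessible (M : FA Q A) (q : Q) : Prop := ∃ t ∈ M.T, ∃ ts, M.IsPath q ts t

/-- An automaton is trim if every state is accessible and coaccessible. -/
def Trim (M : FA Q A) : Prop := ∀ q ∈ M.states, M.Accessible q ∧ M.Coaccessible q

/-- Deterministic: a unique initial state, and at most one transition per state and letter. -/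
def Deterministic (M : FA Q A) : Prop :=
  M.I.card = 1 ∧ ∀ p a q q', (p, a, q) ∈ M.F → (p, a, q') ∈ M.F → q = q'

/-- The language accepted by `M`: labels of paths from an initial to a final state. -/
def lang (M : FA Q A) : Set (FreeMonoid A) :=
  { w | ∃ i ∈ M.I, ∃ t ∈ M.T, ∃ ts, M.IsPath i ts t ∧ label ts = w }

/-- A semi-flower automaton: trim, with unique initial state equal to the unique
final state `one`, and every cycle (non-null path from a state to itself) visits `one`. -/
structure IsSemiFlower (M : FA Q A) (one : Q) : Prop where
  mem : one ∈ M.states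
  init : M.I = {one}
  final : M.T = {one}
  trim : M.Trim
  cyc : ∀ q ts, ts ≠ [] → M.IsPath q ts q → one ∈ statesOf q ts

/-- A cycle simple in `one` : a cycle from `one` to `one` with no intermediate visit to `one`. -/
def SimpleCycleIn (M : FA Q A) (one : Q) (ts : List (Q × A × Q)) : Prop :=
  ts ≠ [] ∧ M.IsPath one ts one ∧ ∀ t ∈ ts.dropLast, t.2.2 ≠ one

/-- `Y_𝒜` : the set of labels of cycles simple in `one`. -/
def Y (M : FA Q A) (one : Q) : Set (FreeMonoid A) :=
  { w | ∃ ts, M.SimpleCycleIn one ts ∧ label ts = w }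

/-- `C_𝒜` : the set of cycles simple in `one`. -/
def C (M : FA Q A) (one : Q) : Set (List (Q × A × Q)) :=
  { ts | M.SimpleCycleIn one ts }

/-- The distance from `p` to `q` : the length of a shortest path from `p` to `q`. -/
noncomputable def dist (M : FA Q A) (p q : Q) : ℕ :=
  sInf { n | ∃ ts, M.IsPath p ts q ∧ ts.length = n }

section Deg

variable [DecidableEq Q] [DecidableEq A]

/-- The indegree of a state: the number of transitions ending at it. -/
def indeg (M : FA Q A) (q : Q) : ℕ := (M.F.filter fun t => t.2.2 = q).card

/-- The outdegree of a state: the number of transitions starting at it. -/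
def outdeg (M : FA Q A) (q : Q) : ℕ := (M.F.filter fun t => t.1 = q).card

/-- A branch point going in (bpi): a state of indegree at least 2. -/
def IsBpi (M : FA Q A) (q : Q) : Prop := 2 ≤ M.indeg q

/-- `BPO_i(𝒜)` : the set of states of outdegree exactly `i`. -/
def BPO (M : FA Q A) (i : ℕ) : Finset Q := M.states.filter fun q => M.outdeg q = i

end Deg

/-- The product automaton. -/
def prod [DecidableEq Q] [DecidableEq Q'] [DecidableEq A]
    (M : FA Q A) (N : FA Q' A) : FA (Q × Q') A where
  states := M.states ×ˢ N.states
  I := M.I ×ˢ N.I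
  T := M.T ×ˢ N.T
  F := ((M.F ×ˢ N.F).filter fun t => t.1.2.1 = t.2.2.1).image
        fun t => ((t.1.1, t.2.1), t.1.2.1, (t.1.2.2, t.2.2.2))
  I_sub := Finset.product_subset_product M.I_sub N.I_sub
  T_sub := Finset.product_subset_product M.T_sub N.T_sub
  F_src := by
    intro t ht
    simp only [Finset.mem_image, Finset.mem_filter, Finset.mem_product] at ht
    obtain ⟨s, ⟨⟨h1, h2⟩, -⟩, rfl⟩ := ht
    exact Finset.mem_product.mpr ⟨M.F_src _ h1, N.F_src _ h2⟩
  F_tgt := by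
    intro t ht
    simp only [Finset.mem_image, Finset.mem_filter, Finset.mem_product] at ht
    obtain ⟨s, ⟨⟨h1, h2⟩, -⟩, rfl⟩ := ht
    exact Finset.mem_product.mpr ⟨M.F_tgt _ h1, N.F_tgt _ h2⟩

open Classical in
/-- The trim part of an automaton: the restriction to states that are both
accessible and coaccessible. -/
noncomputable def trimPart (M : FA Q A) : FA Q A where
  states := M.states.filter fun q => M.Accessible q ∧ M.Coaccessible q
  I := M.I.filter fun q => M.Accessible q ∧ M.Coaccessible q
  T := M.T.filter fun q => M.Accessible q ∧ M.Coaccessible q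
  F := M.F.filter fun t => (M.Accessible t.1 ∧ M.Coaccessible t.1) ∧
        (M.Accessible t.2.2 ∧ M.Coaccessible t.2.2)
  I_sub := by
    intro q hq
    simp only [Finset.mem_filter] at *
    exact ⟨M.I_sub hq.1, hq.2⟩
  T_sub := by
    intro q hq
    simp only [Finset.mem_filter] at *
    exact ⟨M.T_sub hq.1, hq.2⟩
  F_src := by
    intro t ht
    simp only [Finset.mem_filter] at *
    exact ⟨M.F_src _ ht.1, ht.2.1⟩
  F_tgt := by
    intro t ht
    simp only [Finset.mem_filter] at *
    exact ⟨M.F_tgt _ ht.1, ht.2.2⟩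

end FA

/-- The minimal generating set of a submonoid `L` of a free monoid:
`(L ∖ {1}) ∖ (L ∖ {1})·(L ∖ {1})`. -/
def minGen {A : Type*} (L : Set (FreeMonoid A)) : Set (FreeMonoid A) :=
  (L \ {1}) \ ((L \ {1}) * (L \ {1}))

/-- The rank of a submonoid of a free monoid: the cardinality of its (unique)
minimal set of generators. -/
noncomputable def rkL {A : Type*} (L : Set (FreeMonoid A)) : ℕ := (minGen L).ncard

/-- The reduced rank `max (0, rk - 1)` of a submonoid of a free monoid. -/
noncomputable def rrk {A : Type*} (L : Set (FreeMonoid A)) : ℕ := rkL L - 1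

namespace FA

variable {Q A : Type*} {M : FA Q A}

theorem label_append (ts us : List (Q × A × Q)) : label (ts ++ us) = label ts * label us := by
  simp [label]

theorem length_label (ts : List (Q × A × Q)) :
    (FreeMonoid.toList (label ts)).length = ts.length := by
  simp [label]

theorem isPath_append {p q : Q} {ts us : List (Q × A × Q)} :
    M.IsPath p (ts ++ us) q ↔ ∃ r, M.IsPath p ts r ∧ M.IsPath r us q := by
  induction ts generalizing p with
  | nil => simp [IsPath]
  | cons t ts ih => simp [IsPath, ih, and_assoc]

theorem IsPath.mem_F {p q : Q} {ts : List (Q × A × Q)} (h : M.IsPath p ts q) :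
    ∀ t ∈ ts, t ∈ M.F := by
  induction ts generalizing p with
  | nil => simp
  | cons t ts ih =>
    obtain ⟨ht, -, h⟩ := h
    simpa [ht] using fun a b c hm => ih h (a, b, c) hm

/-- In a semi-flower automaton, a path whose transitions never end in `one` never enters the
same state twice. -/
theorem IsSemiFlower.nodup_targets {one : Q} (hsf : M.IsSemiFlower one) {p q : Q}
    {ts : List (Q × A × Q)} (h : M.IsPath p ts q) (hts : ∀ t ∈ ts, t.2.2 ≠ one) :
    (ts.map fun t => t.2.2).Nodup := by
  induction ts generalizing p with
  | nil => simp
  | cons t ts ih =>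
    obtain ⟨-, -, h⟩ := h
    rw [List.map_cons, List.nodup_cons]
    refine ⟨fun hmem => ?_, ih h fun s hs => hts s (List.mem_cons_of_mem _ hs)⟩
    obtain ⟨s, hs, hst⟩ := List.mem_map.1 hmem
    obtain ⟨us, vs, rfl⟩ := List.append_of_mem hs
    obtain ⟨r, hus, hsF, hsr, -⟩ := isPath_append.1 h
    have hcycle : M.IsPath t.2.2 (us ++ [s]) t.2.2 :=
      isPath_append.2 ⟨r, hus, hsF, hsr, hst⟩
    have hone := hsf.cyc _ _ (by simp) hcycle
    rcases List.mem_cons.1 hone with hone | hone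
    · exact hts t List.mem_cons_self hone.symm
    · obtain ⟨u, hu, huone⟩ := List.mem_map.1 hone
      refine hts u ?_ huone
      simp only [List.mem_append, List.mem_cons, List.not_mem_nil, or_false] at hu ⊢
      tauto

theorem SimpleCycleIn.length_le {one : Q} (hsf : M.IsSemiFlower one) {ts : List (Q × A × Q)}
    (h : M.SimpleCycleIn one ts) : ts.length ≤ M.states.card + 1 := by
  classical
  obtain ⟨hne, hpath, hsimple⟩ := h
  rw [← List.dropLast_append_getLast hne] at hpath
  obtain ⟨r, hpath, -⟩ := isPath_append.1 hpath
  have hsub : (ts.dropLast.map fun t => t.2.2).toFinset ⊆ M.states := by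
    intro x hx
    obtain ⟨t, ht, rfl⟩ := List.mem_map.1 (List.mem_toFinset.1 hx)
    exact M.F_tgt t (hpath.mem_F t ht)
  have hcard := Finset.card_le_card hsub
  rw [List.toFinset_card_of_nodup (hsf.nodup_targets hpath hsimple), List.length_map,
    List.length_dropLast] at hcard
  omega

theorem IsSemiFlower.finite_Y [Finite A] {one : Q} (hsf : M.IsSemiFlower one) :
    (M.Y one).Finite := by
  refine (List.finite_length_le A (M.states.card + 1)).subset ?_
  rintro _ ⟨ts, hts, rfl⟩
  exact (length_label ts).trans_le (hts.length_le hsf)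

/-- A non-null path ending in `one` splits at its first entry into `one`. -/
theorem IsPath.exists_first_entry {p one : Q} {ts : List (Q × A × Q)}
    (h : M.IsPath p ts one) (hne : ts ≠ []) :
    ∃ us vs, ts = us ++ vs ∧ us ≠ [] ∧ M.IsPath p us one ∧
      (∀ t ∈ us.dropLast, t.2.2 ≠ one) ∧ M.IsPath one vs one := by
  induction ts generalizing p with
  | nil => exact absurd rfl hne
  | cons t ts ih =>
    obtain ⟨ht, hp, h⟩ := h
    by_cases htone : t.2.2 = one
    · exact ⟨[t], ts, rfl, by simp, ⟨ht, hp, htone⟩, by simp, htone ▸ h⟩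
    · have hts : ts ≠ [] := by
        rintro rfl
        exact htone h
      obtain ⟨us, vs, rfl, hus, hpath, hsimple, hvs⟩ := ih h hts
      refine ⟨t :: us, vs, rfl, by simp, ⟨ht, hp, hpath⟩, ?_, hvs⟩
      rw [List.dropLast_cons_of_ne_nil hus]
      exact List.forall_mem_cons.2 ⟨htone, hsimple⟩

theorem IsPath.label_mem_closure_Y {one : Q} {ts : List (Q × A × Q)}
    (h : M.IsPath one ts one) : label ts ∈ Submonoid.closure (M.Y one) := by
  induction hn : ts.length using Nat.strong_induction_on generalizing ts with
  | _ n ih =>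
    subst hn
    rcases eq_or_ne ts [] with rfl | hne
    · exact one_mem _
    · obtain ⟨us, vs, rfl, hus, hpath, hsimple, hvs⟩ := h.exists_first_entry hne
      rw [label_append]
      refine mul_mem (Submonoid.subset_closure ⟨us, ⟨hus, hpath, hsimple⟩, rfl⟩)
        (ih _ ?_ hvs rfl)
      simpa using List.length_pos_iff.2 hus

theorem exists_isPath_of_mem_closure_Y {one : Q} {w : FreeMonoid A}
    (hw : w ∈ Submonoid.closure (M.Y one)) : ∃ ts, M.IsPath one ts one ∧ label ts = w := by
  induction hw using Submonoid.closure_induction with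
  | mem w hw =>
    obtain ⟨ts, hts, rfl⟩ := hw
    exact ⟨ts, hts.2.1, rfl⟩
  | one => exact ⟨[], rfl, rfl⟩
  | mul v w _ _ hv hw =>
    obtain ⟨ts, hts, rfl⟩ := hv
    obtain ⟨us, hus, rfl⟩ := hw
    exact ⟨ts ++ us, isPath_append.2 ⟨one, hts, hus⟩, label_append ts us⟩

end FA

/-- Giambruno–Restivo: if `M` is a semi-flower automaton over a finite
alphabet `A`, then `Y_𝒜` is finite and `M` recognizes the submonoid generated by `Y_𝒜`. -/
theorem semiFlower_Y_finite_and_lang_eq_closure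
    {Q A : Type*} [Fintype A] (M : FA Q A) (one : Q)
    (hsf : M.IsSemiFlower one) :
    (M.Y one).Finite ∧ M.lang = ↑(Submonoid.closure (M.Y one)) := by
  refine ⟨hsf.finite_Y, Set.ext fun w => ⟨?_, fun hw => ?_⟩⟩
  · rintro ⟨i, hi, t, ht, ts, hts, rfl⟩
    rw [hsf.init, Finset.mem_singleton] at hi
    rw [hsf.final, Finset.mem_singleton] at ht
    subst hi ht
    exact hts.label_mem_closure_Y
  · obtain ⟨ts, hts, rfl⟩ := FA.exists_isPath_of_mem_closure_Y hw
    exact ⟨one, by simp [hsf.init], one, by simp [hsf.final], ts, hts, rfl⟩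
end

section
/- Let 𝒜 be a semi-flower automaton with exactly two bpi's p and q such that the distance from q to the initial-final state 1 is not more than the distance from p to 1. Then there is a unique simple path from q to 1. -/
open Pointwise

namespace FA

variable {Q A : Type*} {M : FA Q A}

theorem isPath_append_singleton {x z : Q} {ts : List (Q × A × Q)} {t : Q × A × Q} :
    M.IsPath x (ts ++ [t]) z ↔ M.IsPath x ts t.1 ∧ t ∈ M.F ∧ t.2.2 = z := by
  induction ts generalizing x with
  | nil => simp only [List.nil_append, IsPath]; tauto
  | cons s ts ih => simp only [List.cons_append, IsPath, ih]; tauto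

theorem IsPath.exists_length_le_of_mem_statesOf {x y z : Q} {ts : List (Q × A × Q)}
    (h : M.IsPath x ts z) (hy : y ∈ statesOf x ts) :
    ∃ us, M.IsPath y us z ∧ us.length ≤ ts.length := by
  induction ts generalizing x with
  | nil =>
    obtain rfl : y = x := by simpa [statesOf] using hy
    exact ⟨[], h, le_rfl⟩
  | cons t ts ih =>
    rcases List.mem_cons.mp hy with rfl | hy
    · exact ⟨_, h, le_rfl⟩
    · obtain ⟨us, hus, hle⟩ := ih h.2.2 hy
      exact ⟨us, hus, hle.trans (Nat.le_succ _)⟩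

theorem IsPath.exists_length_lt_of_mem_targets {x y z : Q} {ts : List (Q × A × Q)}
    (h : M.IsPath x ts z) (hy : y ∈ ts.map fun t => t.2.2) :
    ∃ us, M.IsPath y us z ∧ us.length < ts.length := by
  cases ts with
  | nil => simp at hy
  | cons t ts =>
    obtain ⟨us, hus, hle⟩ := h.2.2.exists_length_le_of_mem_statesOf hy
    exact ⟨us, hus, Nat.lt_succ_of_le hle⟩

theorem IsPath.nodup_statesOf_of_minimal {x z : Q} {ts : List (Q × A × Q)}
    (h : M.IsPath x ts z) (hmin : ∀ us, M.IsPath x us z → ts.length ≤ us.length) :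
    (statesOf x ts).Nodup := by
  induction ts generalizing x with
  | nil => simp [statesOf]
  | cons t ts ih =>
    refine List.nodup_cons.mpr ⟨fun hx => ?_, ih h.2.2 fun us hus => ?_⟩
    · obtain ⟨us, hus, hlt⟩ := h.exists_length_lt_of_mem_targets hx
      exact absurd (hmin us hus) hlt.not_ge
    · simpa using hmin (t :: us) ⟨h.1, h.2.1, hus⟩

theorem dist_le_length {x z : Q} {ts : List (Q × A × Q)} (h : M.IsPath x ts z) :
    M.dist x z ≤ ts.length :=
  Nat.sInf_le ⟨ts, h, rfl⟩

theorem IsPath.exists_length_eq_dist {x z : Q} {ts : List (Q × A × Q)} (h : M.IsPath x ts z) :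
    ∃ us, M.IsPath x us z ∧ us.length = M.dist x z :=
  Nat.sInf_mem (s := {n | ∃ us, M.IsPath x us z ∧ us.length = n}) ⟨_, ts, h, rfl⟩

theorem IsPath.eq_nil_of_nodup {x : Q} {ts : List (Q × A × Q)}
    (h : M.IsPath x ts x) (hn : (statesOf x ts).Nodup) : ts = [] := by
  induction ts using List.reverseRecOn with
  | nil => rfl
  | append_singleton ts t _ =>
    have := (isPath_append_singleton.mp h).2.2
    simp [statesOf, this] at hn

theorem nodup_statesOf_of_append {x : Q} {ts us : List (Q × A × Q)}
    (h : (statesOf x (ts ++ us)).Nodup) : (statesOf x ts).Nodup := by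
  refine h.sublist ?_
  simp [statesOf]

theorem isBpi_of_ne [DecidableEq Q] [DecidableEq A] {t u : Q × A × Q}
    (ht : t ∈ M.F) (hu : u ∈ M.F) (htu : t ≠ u) (h : t.2.2 = u.2.2) : M.IsBpi u.2.2 :=
  Finset.one_lt_card.mpr ⟨t, by simp [ht, h], u, by simp [hu], htu⟩

theorem IsBpi.mem_states [DecidableEq Q] [DecidableEq A] {x : Q} (h : M.IsBpi x) :
    x ∈ M.states := by
  obtain ⟨t, ht⟩ := Finset.card_pos.mp (Nat.lt_of_lt_of_le Nat.zero_lt_two h)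
  obtain ⟨htF, rfl⟩ := Finset.mem_filter.mp ht
  exact M.F_tgt t htF

/-- Read backwards from their common end, two distinct simple paths between the same states
first differ at a bpi other than their origin. -/
theorem IsPath.exists_isBpi_of_ne [DecidableEq Q] [DecidableEq A] {x z : Q}
    {ts us : List (Q × A × Q)} (ht : M.IsPath x ts z) (htn : (statesOf x ts).Nodup)
    (hu : M.IsPath x us z) (hun : (statesOf x us).Nodup) (hne : ts ≠ us) :
    ∃ r, M.IsBpi r ∧ r ≠ x ∧ r ∈ us.map fun t => t.2.2 := by
  induction us using List.reverseRecOn generalizing ts z with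
  | nil =>
    obtain rfl : x = z := hu
    exact absurd (ht.eq_nil_of_nodup htn) hne
  | append_singleton us u ih =>
    rcases List.eq_nil_or_concat' ts with rfl | ⟨ts, t, rfl⟩
    · obtain rfl : x = z := ht
      exact absurd (hu.eq_nil_of_nodup hun).symm hne
    · obtain ⟨ht', htF, rfl⟩ := isPath_append_singleton.mp ht
      obtain ⟨hu', huF, hz⟩ := isPath_append_singleton.mp hu
      by_cases htu : t = u
      · subst htu
        obtain ⟨r, hr, hrx, hmem⟩ := ih ht' (nodup_statesOf_of_append htn) hu'
          (nodup_statesOf_of_append hun) fun h => hne (by rw [h])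
        exact ⟨r, hr, hrx, by simp only [List.map_append, List.mem_append, hmem, true_or]⟩
      · refine ⟨u.2.2, isBpi_of_ne htF huF htu hz.symm, ?_, by simp⟩
        rintro rfl
        simp [statesOf] at hun

end FA

/-- in a semi-flower automaton with exactly two bpi's `p` and `q`, where the
distance from `q` to `1` is not more than that of `p`, there is a unique simple path from
`q` to `1`. -/
theorem unique_simple_path_to_one
    {Q A : Type*} [DecidableEq Q] [DecidableEq A]
    (M : FA Q A) (one p q : Q) (hsf : M.IsSemiFlower one)
    (hpq : p ≠ q) (hp : M.IsBpi p) (hq : M.IsBpi q)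
    (honly : ∀ r, M.IsBpi r → r = p ∨ r = q)
    (hdist : M.dist q one ≤ M.dist p one) :
    ∃! ts, M.IsPath q ts one ∧ (FA.statesOf q ts).Nodup := by
  obtain ⟨z, hz, ts, hts⟩ := (hsf.trim q hq.mem_states).2
  obtain rfl : z = one := by simpa [hsf.final] using hz
  obtain ⟨us, hus, hlen⟩ := hts.exists_length_eq_dist
  have hun : (FA.statesOf q us).Nodup :=
    hus.nodup_statesOf_of_minimal fun vs hvs => hlen.trans_le (FA.dist_le_length hvs)
  refine ⟨us, ⟨hus, hun⟩, fun vs ⟨hvs, hvn⟩ => ?_⟩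
  by_contra hne
  obtain ⟨r, hr, hrq, hmem⟩ := hvs.exists_isBpi_of_ne hvn hus hun hne
  obtain rfl := (honly r hr).resolve_right hrq
  obtain ⟨ws, hws, hlt⟩ := hus.exists_length_lt_of_mem_targets hmem
  have := FA.dist_le_length hws
  omega
end

section
/- If 𝒜 = (Q, 1, 1, F) is a semi-flower automaton with a unique bpi whose indegree is k, then |F| = |Q| − 1 + k. -/
open Pointwise

namespace FA

variable {Q A : Type*} [DecidableEq Q]

/-- The end of a non-null path has positive indegree. -/
lemma IsPath.indeg_pos {M : FA Q A} {p q : Q} {ts : List (Q × A × Q)}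
    (h : M.IsPath p ts q) (hne : ts ≠ []) : 0 < M.indeg q := by
  induction ts generalizing p with
  | nil => exact absurd rfl hne
  | cons t ts ih =>
    obtain ⟨ht, -, h⟩ := h
    rcases eq_or_ne ts [] with rfl | hts
    · exact Finset.card_pos.mpr ⟨t, Finset.mem_filter.mpr ⟨ht, h⟩⟩
    · exact ih h hts

/-- The transitions are counted by the indegrees of the states. -/
lemma sum_indeg (M : FA Q A) : ∑ q ∈ M.states, M.indeg q = M.F.card :=
  (Finset.card_eq_sum_card_fiberwise M.F_tgt).symm

/-- In a semi-flower automaton with at least one transition, every state has positive indegree. -/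
lemma IsSemiFlower.indeg_pos {M : FA Q A} {one : Q} (h : M.IsSemiFlower one)
    (hF : M.F.Nonempty) {q : Q} (hq : q ∈ M.states) : 0 < M.indeg q := by
  rcases eq_or_ne q one with rfl | hne
  · obtain ⟨t, ht⟩ := hF
    obtain ⟨f, hf, ts, hts⟩ := (h.trim _ (M.F_tgt t ht)).2
    rw [h.final, Finset.mem_singleton] at hf
    subst hf
    exact IsPath.indeg_pos (p := t.1) (ts := t :: ts) ⟨ht, rfl, hts⟩ (List.cons_ne_nil _ _)
  · obtain ⟨i, hi, ts, hts⟩ := (h.trim q hq).1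
    rw [h.init, Finset.mem_singleton] at hi
    subst hi
    refine hts.indeg_pos ?_
    rintro rfl
    exact hne (Eq.symm hts)

end FA

/-- if `M` is a semi-flower automaton with a unique bpi whose indegree
is `k`, then `|F| = |Q| - 1 + k`. -/
theorem card_F_unique_bpi
    {Q A : Type*} [DecidableEq Q] [DecidableEq A]
    (M : FA Q A) (one b : Q) (k : ℕ) (hsf : M.IsSemiFlower one)
    (hb : M.IsBpi b) (huniq : ∀ b', M.IsBpi b' → b' = b) (hk : k = M.indeg b) :
    M.F.card = M.states.card - 1 + k := by
  have hpos : 0 < M.indeg b := two_pos.trans_le hb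
  obtain ⟨t, ht⟩ := Finset.card_pos.mp hpos
  obtain ⟨htF, htb⟩ := Finset.mem_filter.mp ht
  have hbs : b ∈ M.states := htb ▸ M.F_tgt t htF
  have hone : ∀ q ∈ M.states.erase b, M.indeg q = 1 := by
    intro q hq
    obtain ⟨hqb, hqs⟩ := Finset.mem_erase.mp hq
    have hle : ¬ 2 ≤ M.indeg q := fun h => hqb (huniq q h)
    have := hsf.indeg_pos ⟨t, htF⟩ hqs
    omega
  rw [← M.sum_indeg, ← Finset.sum_erase_add _ _ hbs, Finset.sum_congr rfl hone,
    ← Finset.card_eq_sum_ones, Finset.card_erase_of_mem hbs, hk]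
end
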